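/- Let f:ℤ→ℂ be odd and periodic modulo an odd prime p. Then D_k(1,f) = 2·(π/2)^k · Σ_{r=1}^{(p-1)/2} f(r)·x_k(r;p), where D_k(1,f) is the value at s=1 of the analytic continuation of Σ_{n≥1} d_k(n)f(n)n^{-s}. -/

import Mathlib

open scoped Real

noncomputable def xk (k p : ℕ) [NeZero p] (r : ZMod p) : ℝ :=
  ((p : ℝ))⁻¹ ^ k *
    ∑ m ∈ Finset.univ.filter (fun m : Fin k → (ZMod p)ˣ => ∏ i, ((m i : ZMod p)) = r),
      ∏ i, Real.cot (π * ((m i : ZMod p).val : ℝ) / p)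

/-- The `k`-fold divisor function. -/
def dk (k n : ℕ) : ℕ :=
  ((Fintype.piFinset fun _ : Fin k => Finset.range (n + 1)).filter
    (fun f => ∏ i, f i = n)).card


open Filter Topology in
lemma rpow_diff_bound {c x y s : ℝ} {n : ℕ} (hc : 0 < c) (hc1 : c ≤ 1) (hs : 1 < s) (hs2 : s ≤ 2)
    (hx : n + c ≤ x) (hy : n + c ≤ y) (hxy : |x - y| ≤ 1) :
    |x ^ (-s) - y ^ (-s)| ≤ 2 * (c ^ (-3 : ℝ)) * (1 / ((n : ℝ) + 1) ^ 2) := by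
  have hpos : ∀ z ∈ Set.Ici ((n : ℝ) + c), 0 < z := fun z hz => by
    have : (n : ℝ) + c ≤ z := hz
    have : (0 : ℝ) ≤ n := by positivity
    linarith
  have key := (convex_Ici ((n : ℝ) + c)).norm_image_sub_le_of_norm_hasDerivWithin_le
    (f := fun z : ℝ => z ^ (-s)) (f' := fun z => (-s) * z ^ (-s - 1))
    (C := 2 * (c ^ (-3 : ℝ)) * (1 / ((n : ℝ) + 1) ^ 2)) (x := y) (y := x)
    (fun z hz => (Real.hasDerivAt_rpow_const (Or.inl (hpos z hz).ne')).hasDerivWithinAt)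
    (fun z hz => ?_) hy hx
  · refine key.trans ?_
    rw [Real.norm_eq_abs]
    exact mul_le_of_le_one_right (by positivity) hxy
  · have hz' : (n : ℝ) + c ≤ z := hz
    have hz0 := hpos z hz
    have hn : (0 : ℝ) ≤ n := by positivity
    rw [norm_mul, Real.norm_eq_abs, Real.norm_eq_abs, abs_neg, abs_of_pos (by linarith),
      abs_of_pos (Real.rpow_pos_of_pos hz0 _), mul_assoc]
    have h1 : z ^ (-s - 1) ≤ (c * (n + 1)) ^ (-s - 1) :=
      Real.rpow_le_rpow_of_nonpos (by positivity) (by nlinarith) (by linarith)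
    rw [Real.mul_rpow hc.le (by positivity)] at h1
    have h2 : c ^ (-s - 1) ≤ c ^ (-3 : ℝ) :=
      Real.rpow_le_rpow_of_exponent_ge hc hc1 (by linarith)
    have h3 : ((n : ℝ) + 1) ^ (-s - 1) ≤ 1 / ((n : ℝ) + 1) ^ 2 := by
      have : ((n : ℝ) + 1) ^ (-s - 1) ≤ ((n : ℝ) + 1) ^ (-2 : ℝ) :=
        Real.rpow_le_rpow_of_exponent_le (by linarith) (by linarith)
      refine this.trans (le_of_eq ?_)
      rw [Real.rpow_neg (by positivity), one_div]
      norm_cast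
    have h4 := mul_le_mul h2 h3 (by positivity) (by positivity)
    exact mul_le_mul hs2 (h1.trans h4) (by positivity) (by norm_num)

open Filter Topology in
lemma hurwitzZetaOdd_one {a : ℝ} (h0 : 0 < a) (h1 : a < 1) :
    HurwitzZeta.hurwitzZetaOdd (a : UnitAddCircle) 1 = ((π / 2 * Real.cot (π * a) : ℝ) : ℂ) := by
  set c := min a (1 - a) with hc
  have hc0 : 0 < c := lt_min h0 (by linarith)
  have hca : c ≤ a := min_le_left _ _
  have hca' : c ≤ 1 - a := min_le_right _ _
  let φ : ℝ → ℕ → ℂ := fun s n => (((n + a : ℝ) ^ (-s) - (n + 1 - a : ℝ) ^ (-s)) / 2 : ℝ)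
  let bd : ℕ → ℝ := fun n => 2 * (c ^ (-3 : ℝ)) * (1 / ((n : ℝ) + 1) ^ 2)
  have hbd : Summable bd := by
    refine Summable.mul_left _ ?_
    have := (summable_nat_add_iff 1).mpr (Real.summable_one_div_nat_pow (p := 2).mpr (by norm_num))
    simpa [Function.comp_def] using this
  have hlim : ∀ n, Tendsto (φ · n) (𝓝[>] 1) (𝓝 (φ 1 n)) := by
    intro n
    refine Tendsto.mono_left ?_ nhdsWithin_le_nhds
    have hn : (0 : ℝ) ≤ n := by positivity
    have : Continuous (φ · n) := by
      refine Complex.continuous_ofReal.comp (Continuous.div_const (Continuous.sub ?_ ?_) _)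
      · exact Real.continuous_const_rpow (by linarith) |>.comp continuous_neg
      · exact Real.continuous_const_rpow (by linarith) |>.comp continuous_neg
    exact this.tendsto 1
  have hev : ∀ᶠ s : ℝ in 𝓝[>] 1, 1 < s ∧ s ≤ 2 := by
    filter_upwards [Ioc_mem_nhdsGT (show (1 : ℝ) < 2 by norm_num)] with s hs
    exact hs
  have hb : ∀ᶠ s : ℝ in 𝓝[>] 1, ∀ n, ‖φ s n‖ ≤ bd n := by
    filter_upwards [hev] with s hs n
    have := rpow_diff_bound (n := n) (x := n + a) (y := n + 1 - a) hc0 (by linarith) hs.1 hs.2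
      (by linarith) (by linarith) (by rw [abs_le]; constructor <;> linarith)
    simp only [φ, Complex.norm_real, Real.norm_eq_abs, abs_div]
    rw [abs_of_pos (show (0 : ℝ) < 2 by norm_num)]
    have h := abs_nonneg (((n + a : ℝ) ^ (-s) - (n + 1 - a : ℝ) ^ (-s)))
    simp only [bd]
    linarith
  have T := tendsto_tsum_of_dominated_convergence hbd hlim hb
  have T2 : Tendsto (fun s : ℝ => HurwitzZeta.hurwitzZetaOdd (a : UnitAddCircle) s) (𝓝[>] 1)
      (𝓝 (HurwitzZeta.hurwitzZetaOdd (a : UnitAddCircle) 1)) := by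
    refine Tendsto.mono_left ?_ nhdsWithin_le_nhds
    have := ((HurwitzZeta.differentiable_hurwitzZetaOdd (a : UnitAddCircle)).continuous.comp
      Complex.continuous_ofReal).tendsto 1
    simpa [Function.comp_def] using this
  have E1 : HurwitzZeta.hurwitzZetaOdd (a : UnitAddCircle) 1 = ∑' n, φ 1 n := by
    refine tendsto_nhds_unique T2 (T.congr' ?_)
    filter_upwards [hev] with s hs
    rw [← (HurwitzZeta.hasSum_nat_hurwitzZetaOdd_of_mem_Icc (a := a) ⟨h0.le, h1.le⟩
      (s := (s : ℂ)) (by simpa using hs.1)).tsum_eq]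
    refine tsum_congr fun n => ?_
    have hn : (0 : ℝ) ≤ n := by positivity
    simp only [φ]
    rw [Real.rpow_neg (by linarith), Real.rpow_neg (by linarith)]
    push_cast
    rw [Complex.ofReal_cpow (by linarith), Complex.ofReal_cpow (by linarith)]
    push_cast
    simp [one_div]
  have hsum : Summable (φ 1) := by
    refine Summable.of_norm_bounded hbd fun n => ?_
    exact le_of_tendsto (hlim n).norm (hb.mono fun s hs => hs n)
  rw [E1]
  have P1 := hsum.hasSum.tendsto_sum_nat
  have hint : (a : ℂ) ∈ Complex.integerComplement := by
    rintro ⟨m, hm⟩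
    have hm' : (m : ℝ) = a := by exact_mod_cast hm
    rw [← hm'] at h0 h1
    have h0' : 0 < m := by exact_mod_cast h0
    have h1' : m < 1 := by exact_mod_cast h1
    omega
  have P2 := tendsto_logDeriv_euler_cot_sub hint
  have P3 : Tendsto (fun N : ℕ => (1 / ((a : ℂ) + N))) atTop (𝓝 0) := by
    have : Tendsto (fun N : ℕ => (1 / (a + N) : ℝ)) atTop (𝓝 0) := by
      simp only [one_div]
      exact (tendsto_atTop_add_const_left _ a tendsto_natCast_atTop_atTop).inv_tendsto_atTop
    have := (Complex.continuous_ofReal.tendsto 0).comp this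
    simpa [Function.comp_def] using this
  have key : ∀ N : ℕ, ∑ i ∈ Finset.range N, φ 1 i =
      (1 / (a : ℂ) + ∑ i ∈ Finset.range N, cotTerm (a : ℂ) i - 1 / ((a : ℂ) + N)) / 2 := by
    intro N
    induction N with
    | zero => simp
    | succ N ih =>
      rw [Finset.sum_range_succ, Finset.sum_range_succ, ih]
      have hn : (0 : ℝ) ≤ N := by positivity
      simp only [φ, cotTerm]
      rw [Real.rpow_neg_one, Real.rpow_neg_one]
      have e : (1 : ℂ) / (a - (N + 1)) = - (1 / (N + 1 - a)) := by
        rw [← neg_sub ((N : ℂ) + 1), div_neg]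
      rw [e]
      push_cast
      rw [add_comm (N : ℂ) a]
      ring
  have P4 := ((P2.const_add (1 / (a : ℂ))).sub P3).div_const 2
  rw [tendsto_nhds_unique (P1.congr key) P4]
  push_cast
  ring

lemma dk_eq (k n : ℕ) (hn : n ≠ 0) : dk k n = (Nat.finMulAntidiag k n).card := by
  unfold dk
  congr 1
  ext f
  simp only [Finset.mem_filter, Fintype.mem_piFinset, Finset.mem_range, Nat.mem_finMulAntidiag]
  constructor
  · rintro ⟨_, h⟩; exact ⟨h, hn⟩
  · rintro ⟨h, _⟩
    refine ⟨fun i => Nat.lt_succ_of_le (Nat.le_of_dvd (Nat.pos_of_ne_zero hn) ?_), h⟩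
    rw [← h]; exact Finset.dvd_prod_of_mem _ (Finset.mem_univ i)

lemma dk_zero_right (k : ℕ) : dk 0 k = if k = 1 then 1 else 0 := by
  unfold dk
  split_ifs with h
  · subst h; simp
  · rw [Finset.card_eq_zero, Finset.filter_eq_empty_iff]
    intro f _ hf
    simp at hf; exact h hf.symm

lemma dk_succ (k n : ℕ) (hn : n ≠ 0) :
    dk (k + 1) n = ∑ q ∈ n.divisorsAntidiagonal, dk k q.2 := by
  rw [dk_eq _ _ hn]
  have : ∀ q ∈ n.divisorsAntidiagonal, dk k q.2 = (Nat.finMulAntidiag k q.2).card := by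
    intro q hq
    exact dk_eq _ _ (Nat.ne_zero_of_mem_divisorsAntidiagonal hq).2
  rw [Finset.sum_congr rfl this, ← Finset.card_sigma]
  refine Finset.card_bij' (fun f _ => ⟨(f 0, ∏ i, Fin.tail f i), Fin.tail f⟩)
    (fun x _ => Fin.cons x.1.1 x.2) ?_ ?_ ?_ ?_
  · intro f hf
    rw [Nat.mem_finMulAntidiag, Fin.prod_univ_succ] at hf
    have h2 : ∏ i, Fin.tail f i ≠ 0 := by
      intro h; apply hn; rw [← hf.1]; simp only [Fin.tail] at h; rw [h, mul_zero]
    simp only [Finset.mem_sigma, Nat.mem_divisorsAntidiagonal, Nat.mem_finMulAntidiag]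
    exact ⟨⟨hf.1, hn⟩, trivial, h2⟩
  · rintro ⟨⟨u, v⟩, f⟩ h
    simp only [Finset.mem_sigma, Nat.mem_divisorsAntidiagonal, Nat.mem_finMulAntidiag] at h ⊢
    simp [Fin.prod_univ_succ, h.2.1, h.1.1, hn]
  · intro f hf; simp
  · rintro ⟨⟨u, v⟩, f⟩ h
    simp only [Finset.mem_sigma, Nat.mem_divisorsAntidiagonal, Nat.mem_finMulAntidiag] at h
    have := h.2.1
    subst this
    simp

noncomputable def GG (p : ℕ) [NeZero p] (b : ZMod p) (s : ℂ) : ℂ :=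
  (p : ℂ) ^ (-s) * HurwitzZeta.hurwitzZetaOdd (ZMod.toAddCircle b) s

noncomputable def dl (p : ℕ) (b : ZMod p) : ZMod p → ℂ := fun x => if x = b then 1 else 0

lemma GG_eq (p : ℕ) [NeZero p] (b : ZMod p) {s : ℂ} (hs : 1 < s.re) :
    GG p b s = (LSeries (fun n => dl p b n) s - LSeries (fun n => dl p (-b) n) s) / 2 := by
  rw [← ZMod.LFunction_eq_LSeries _ hs, ← ZMod.LFunction_eq_LSeries _ hs, GG,
    HurwitzZeta.hurwitzZetaOdd_eq]
  simp [ZMod.LFunction, dl]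
  ring

lemma main_hasSum (p : ℕ) [NeZero p] {s : ℂ} (hs : 1 < s.re) (k : ℕ) :
    ∀ F : ZMod p → ℂ, (∀ x, F (-x) = - F x) →
    LSeriesHasSum (fun n => (dk k n : ℂ) * F n) s
      (∑ a : Fin k → ZMod p, F (∏ i, a i) * ∏ i, GG p (a i) s) := by
  induction k with
  | zero =>
    intro F hF
    unfold LSeriesHasSum
    have := hasSum_single (f := LSeries.term (fun n => (dk 0 n : ℂ) * F n) s) 1 (by
      intro n hn
      simp [LSeries.term, dk_zero_right, hn])
    simpa [LSeries.term, dk_zero_right] using this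
  | succ k ih =>
    intro F hF
    let V : ZMod p → ℂ := fun b => ∑ a : Fin k → ZMod p, F (b * ∏ i, a i) * ∏ i, GG p (a i) s
    have hV : ∀ b, V (-b) = - V b := by
      intro b
      simp only [V, neg_mul, hF, Finset.sum_neg_distrib]
    have hval : ∑ a : Fin (k + 1) → ZMod p, F (∏ i, a i) * ∏ i, GG p (a i) s =
        ∑ b, LSeries (fun n => dl p b n) s * V b := by
      rw [← (Fin.consEquiv (fun _ : Fin (k + 1) => ZMod p)).sum_comp, Fintype.sum_prod_type]
      simp only [Fin.consEquiv_apply, Fin.prod_univ_succ, Fin.cons_zero, Fin.cons_succ]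
      have e1 : ∀ b : ZMod p, ∑ y : Fin k → ZMod p, F (b * ∏ i, y i) *
          (GG p b s * ∏ i, GG p (y i) s) = GG p b s * V b := by
        intro b
        rw [Finset.mul_sum]
        exact Finset.sum_congr rfl fun _ _ => by ring
      refine (Finset.sum_congr rfl fun b _ => e1 b).trans ?_
      have e2 : ∑ b, LSeries (fun n => dl p (-b) n) s * V b =
          - ∑ b, LSeries (fun n => dl p b n) s * V b := by
        rw [← Equiv.sum_comp (Equiv.neg (ZMod p))]
        simp [hV]
      have e3 : ∑ b, GG p b s * V b = (∑ b, LSeries (fun n => dl p b n) s * V b -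
          ∑ b, LSeries (fun n => dl p (-b) n) s * V b) / 2 := by
        rw [← Finset.sum_sub_distrib, Finset.sum_div]
        refine Finset.sum_congr rfl fun b _ => ?_
        rw [GG_eq p b hs]; ring
      rw [e3, e2]; ring
    rw [hval]
    have hconv : ∀ b : ZMod p, LSeriesHasSum
        (LSeries.convolution (fun n => dl p b n) (fun n => (dk k n : ℂ) * F (b * n))) s
        (LSeries (fun n => dl p b n) s * V b) := by
      intro b
      exact LSeriesHasSum.convolution
        (ZMod.LSeriesSummable_of_one_lt_re _ hs).LSeriesHasSum
        (ih (fun x => F (b * x)) (fun x => by rw [mul_neg, hF]))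
    have hs' := hasSum_sum (s := Finset.univ) fun b _ => hconv b
    unfold LSeriesHasSum
    refine hs'.congr_fun fun n => ?_
    rcases eq_or_ne n 0 with rfl | hn
    · simp
    · simp only [LSeries.term_of_ne_zero hn, ← Finset.sum_div]
      congr 1
      simp only [LSeries.convolution_def]
      rw [Finset.sum_comm, dk_succ k n hn]
      push_cast
      rw [Finset.sum_mul]
      refine Finset.sum_congr rfl fun q hq => ?_
      rw [← (Nat.mem_divisorsAntidiagonal.mp hq).1]
      simp [dl]

noncomputable def cc (p : ℕ) (b : ZMod p) : ℝ := Real.cot (π * (b.val : ℝ) / p)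

lemma cc_zero (p : ℕ) : cc p 0 = 0 := by
  simp [cc, Real.cot_eq_cos_div_sin]

lemma cc_neg (p : ℕ) [NeZero p] (b : ZMod p) : cc p (-b) = - cc p b := by
  by_cases hb : b = 0
  · subst hb; simp [cc_zero]
  · have hp : (p : ℝ) ≠ 0 := Nat.cast_ne_zero.mpr (NeZero.ne p)
    have : π * (((-b).val : ℕ) : ℝ) / p = π - π * (b.val : ℝ) / p := by
      rw [ZMod.neg_val, if_neg hb, Nat.cast_sub (ZMod.val_lt b).le]
      field_simp
    rw [cc, cc, this, Real.cot_eq_cos_div_sin, Real.cot_eq_cos_div_sin, Real.cos_pi_sub,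
      Real.sin_pi_sub, neg_div]

lemma GG_one (p : ℕ) [NeZero p] (b : ZMod p) :
    GG p b 1 = ((π / 2 * (p : ℝ)⁻¹ * cc p b : ℝ) : ℂ) := by
  by_cases hb : b = 0
  · subst hb
    have : HurwitzZeta.hurwitzZetaOdd (0 : UnitAddCircle) 1 = 0 := by
      rw [HurwitzZeta.hurwitzZetaOdd_eq]; simp
    simp [GG, cc_zero, this]
  · have hp : (0 : ℝ) < p := Nat.cast_pos.mpr (NeZero.pos p)
    have h0 : (0 : ℝ) < b.val / p := by
      have : 0 < b.val := Nat.pos_of_ne_zero (by rwa [ne_eq, ZMod.val_eq_zero])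
      positivity
    have h1 : (b.val / p : ℝ) < 1 := by
      rw [div_lt_one hp]; exact_mod_cast ZMod.val_lt b
    rw [GG, ZMod.toAddCircle_apply, hurwitzZetaOdd_one h0 h1, Complex.cpow_neg_one, cc,
      mul_div_assoc]
    push_cast
    ring

noncomputable def XX (k p : ℕ) [NeZero p] (r : ZMod p) : ℝ :=
  ∑ m ∈ Finset.univ.filter (fun m : Fin k → (ZMod p)ˣ => ∏ i, ((m i : ZMod p)) = r),
      ∏ i, cc p (m i)

lemma XX_neg (k p : ℕ) [NeZero p] (hk : 0 < k) (r : ZMod p) : XX k p (-r) = - XX k p r := by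
  obtain ⟨k, rfl⟩ : ∃ j, k = j + 1 := ⟨k - 1, by omega⟩
  unfold XX
  rw [← Finset.sum_neg_distrib, Finset.sum_filter, Finset.sum_filter,
    ← Equiv.sum_comp (Equiv.mulLeft (Pi.mulSingle (0 : Fin (k + 1)) (-1 : (ZMod p)ˣ)))]
  refine Finset.sum_congr rfl fun m _ => ?_
  simp [Fin.prod_univ_succ, cc_neg, Pi.mulSingle_apply]

lemma sum_units (k p : ℕ) [NeZero p] (hp : p.Prime) (F : ZMod p → ℂ) :
    ∑ a : Fin k → ZMod p, F (∏ i, a i) * ∏ i, (cc p (a i) : ℂ) =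
      ∑ r : ZMod p, F r * XX k p r := by
  have : Fact p.Prime := ⟨hp⟩
  have h1 : ∑ r : ZMod p, F r * XX k p r =
      ∑ m : Fin k → (ZMod p)ˣ, F (∏ i, (m i : ZMod p)) * ∏ i, (cc p (m i) : ℂ) := by
    simp only [XX, Finset.sum_filter]
    push_cast
    simp only [Finset.mul_sum]
    rw [Finset.sum_comm]
    refine Finset.sum_congr rfl fun m _ => ?_
    rw [Finset.sum_eq_single (∏ i, (m i : ZMod p))]
    · simp
    · intro b _ hb
      simp [hb.symm]
    · simp
  rw [h1]
  symm
  refine Finset.sum_of_injOn (fun m i => (m i : ZMod p)) ?_ ?_ ?_ ?_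
  · intro m _ m' _ h
    funext i
    exact Units.ext (congrFun h i)
  · simp
  · intro a _ ha
    have : ∃ i, a i = 0 := by
      by_contra! hcon
      apply ha
      exact ⟨fun i => Units.mk0 (a i) (hcon i), by simp, by simp⟩
    obtain ⟨i, hi⟩ := this
    have hz : ∏ i, (cc p (a i) : ℂ) = 0 :=
      Finset.prod_eq_zero (Finset.mem_univ i) (by rw [hi, cc_zero]; simp)
    rw [hz, mul_zero]
  · intro m _; rfl

lemma sum_half (p : ℕ) [NeZero p] (hodd : Odd p) (H : ZMod p → ℂ) (h0 : H 0 = 0)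
    (hev : ∀ x, H (-x) = H x) :
    ∑ r : ZMod p, H r = 2 * ∑ r ∈ Finset.Icc 1 ((p - 1) / 2), H (r : ZMod p) := by
  obtain ⟨q, rfl⟩ := hodd
  have e0 : (2 * q + 1 - 1) / 2 = q := by omega
  have e1 : ∑ r : ZMod (2 * q + 1), H r = ∑ r ∈ Finset.range (2 * q + 1), H (r : ZMod (2 * q + 1)) := by
    rw [Finset.sum_range]
    refine Finset.sum_congr rfl fun r _ => ?_
    congr 1
    exact (ZMod.natCast_zmod_val r).symm
  rw [e0, e1, Finset.sum_range_succ', Nat.cast_zero, h0, add_zero,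
    show Finset.range (2 * q) = Finset.range (q + q) by rw [two_mul], Finset.sum_range_add]
  have e2 : ∑ r ∈ Finset.Icc 1 q, H (r : ZMod (2 * q + 1)) =
      ∑ i ∈ Finset.range q, H ((i + 1 : ℕ) : ZMod (2 * q + 1)) := by
    rw [Finset.sum_bij' (fun i _ => i - 1) (fun i _ => i + 1)]
    all_goals simp
    all_goals intros
    all_goals first | omega | (congr 2; done) | skip
    rename_i a h1 h2
    obtain ⟨b, rfl⟩ : ∃ b, a = b + 1 := ⟨a - 1, by omega⟩
    simp
  rw [e2, two_mul (Finset.sum _ _)]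
  congr 1
  rw [← Finset.sum_range_reflect]
  refine Finset.sum_congr rfl fun i hi => ?_
  rw [← hev]
  congr 1
  have hi' := Finset.mem_range.mp hi
  rw [neg_eq_iff_add_eq_zero, ← Nat.cast_add]
  rw [show q + (q - 1 - i) + 1 + (i + 1) = 2 * q + 1 by omega]
  exact ZMod.natCast_self _

theorem stmt13 (p k : ℕ) [NeZero p] (hp : p.Prime) (hodd : Odd p) (hk : 0 < k)
    (f : ℤ → ℂ) (hoddf : ∀ n : ℤ, f (-n) = -f n) (hper : ∀ n : ℤ, f (n + p) = f n)
    (g : ℂ → ℂ) (hg : Differentiable ℂ g)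
    (hagree : ∀ s : ℂ, 1 < s.re →
      g s = ∑' n : ℕ, (dk k (n + 1) : ℂ) * f (n + 1) / ((n : ℂ) + 1) ^ s) :
    g 1 = 2 * ((π / 2 : ℝ) : ℂ) ^ k *
      ∑ r ∈ Finset.Icc 1 ((p - 1) / 2), f r * (xk k p (r : ZMod p) : ℂ) := by
  have hper' : Function.Periodic f (p : ℤ) := hper
  let F : ZMod p → ℂ := fun x => f (x.val : ℤ)
  have hF : ∀ n : ℤ, F (n : ZMod p) = f n := by
    intro n
    simp only [F]
    rw [ZMod.val_intCast]
    have := hper'.int_mul (n / p) (n % p)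
    rw [← this]
    congr 1
    have := Int.emod_add_mul_ediv n p
    simp only [Int.cast_id]
    linarith
  have hFn : ∀ n : ℕ, F (n : ZMod p) = f n := fun n => by
    have := hF n
    rwa [Int.cast_natCast] at this
  have hFodd : ∀ x, F (-x) = - F x := by
    intro x
    obtain ⟨n, rfl⟩ := ZMod.intCast_surjective x
    rw [← Int.cast_neg, hF, hF, hoddf]
  let A : ℂ → ℂ := fun s => ∑ a : Fin k → ZMod p, F (∏ i, a i) * ∏ i, GG p (a i) s
  have hp0 : (p : ℂ) ≠ 0 := Nat.cast_ne_zero.mpr (NeZero.ne p)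
  have hGG : ∀ b, Differentiable ℂ (GG p b) := by
    intro b
    refine Differentiable.mul ?_ (HurwitzZeta.differentiable_hurwitzZetaOdd _)
    intro s
    exact (differentiableAt_id.neg).const_cpow (Or.inl hp0)
  have hA : Differentiable ℂ A := by
    refine Differentiable.fun_sum fun a _ => Differentiable.const_mul ?_ _
    exact Differentiable.fun_finsetProd fun i _ => hGG _
  have hagree2 : ∀ s : ℂ, 1 < s.re → g s = A s := by
    intro s hs
    have h := main_hasSum p hs k F hFodd
    rw [hagree s hs]
    have h2 := (hasSum_nat_add_iff' 1).mpr h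
    simp only [Finset.sum_range_one, LSeries.term_zero, sub_zero] at h2
    refine Eq.trans ?_ h2.tsum_eq
    refine tsum_congr fun n => ?_
    rw [LSeries.term_of_ne_zero (Nat.succ_ne_zero n), hFn]
    push_cast
    rfl
  have hgA : g = A := by
    refine AnalyticOnNhd.eq_of_eventuallyEq (z₀ := 2)
      (fun z _ => hg.analyticAt z) (fun z _ => hA.analyticAt z) ?_
    have : {s : ℂ | 1 < s.re} ∈ nhds (2 : ℂ) :=
      (isOpen_lt continuous_const Complex.continuous_re).mem_nhds (by simp)
    filter_upwards [this] with s hs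
    exact hagree2 s hs
  rw [hgA]
  simp only [A, GG_one]
  push_cast
  simp only [Finset.prod_mul_distrib, Finset.prod_const, Finset.card_univ, Fintype.card_fin]
  have e : ∀ a : Fin k → ZMod p, F (∏ i, a i) *
      (((π : ℂ) / 2) ^ k * ((p : ℂ)⁻¹) ^ k * ∏ i, (cc p (a i) : ℂ)) =
      ((π : ℂ) / 2) ^ k * ((p : ℂ)⁻¹) ^ k * (F (∏ i, a i) * ∏ i, (cc p (a i) : ℂ)) :=
    fun a => by ring
  simp only [e]
  have hF0 : F 0 = 0 := by
    have := hFodd 0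
    rw [neg_zero] at this
    exact self_eq_neg.mp this
  rw [← Finset.mul_sum, sum_units k p hp, sum_half p hodd _ (by rw [hF0, zero_mul])
    (fun x => by rw [hFodd, XX_neg k p hk]; push_cast; ring)]
  have hx : ∀ r : ℕ, f r * (xk k p (r : ZMod p) : ℂ) =
      ((p : ℂ)⁻¹) ^ k * (F (r : ZMod p) * XX k p (r : ZMod p)) := by
    intro r
    rw [hFn, show xk k p (r : ZMod p) = ((p : ℝ))⁻¹ ^ k * XX k p (r : ZMod p) from rfl]
    push_cast
    ring
  simp only [hx]
  rw [← Finset.mul_sum]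
  ring
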